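/- Assume 𝔠 is a regular cardinal and let κ ≤ 𝔠 be an infinite regular cardinal. Then there is a barely independent family over 𝔠 of cardinality κ if and only if 𝔯(ω,κ) = 𝔠. -/

import Mathlib

open Cardinal Set

/-- The boolean combination `⋂_{A ∈ 𝓐} A^{h(A)}`, where `A^0 = A` and `A^1` is the
complement of `A`. -/
def BoolComb {α : Type} (𝓐 : Set (Set α)) (h : Set α → Fin 2) : Set α :=
  ⋂ A ∈ 𝓐, if h A = 0 then A else Aᶜ

/-- A family `I` of subsets of a set `α` (of cardinality `λ = #α`) is `κ`-barely independent
over `α` if all its members have cardinality `#α`, `|I| ≥ κ`, every boolean combination of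
fewer than `κ` members has cardinality `#α`, and every boolean combination of exactly `κ`
members has cardinality `< #α`. -/
def KBarelyIndependent {α : Type} (κ : Cardinal) (I : Set (Set α)) : Prop :=
  κ ≤ #I ∧ (∀ A ∈ I, #A = #α) ∧
  (∀ 𝓐 ⊆ I, 𝓐.Nonempty → #𝓐 < κ → ∀ h : Set α → Fin 2, #(BoolComb 𝓐 h) = #α) ∧
  (∀ 𝓐 ⊆ I, #𝓐 = κ → ∀ h : Set α → Fin 2, #(BoolComb 𝓐 h) < #α)

/-- `S` splits `R` if both `R ∩ S` and `R \ S` are infinite. (`R` reaps `S` otherwise.) -/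
def Splits {α : Type} (S R : Set α) : Prop := (R ∩ S).Infinite ∧ (R \ S).Infinite

/-- The generalized reaping number `𝔯(κ, λ)`: the least cardinality of a family `R` of
`κ`-sized subsets of `λ` such that every `S ⊆ λ` is reaped by some member of `R`. -/
noncomputable def reapingNumber (κ lam : Cardinal) : Cardinal :=
  sInf {c | ∃ R : Set (Set lam.out), #R = c ∧ (∀ r ∈ R, #r = κ) ∧
    ∀ S : Set lam.out, ∃ r ∈ R, ¬ Splits S r}

theorem mem_boolComb {α : Type} {𝓐 : Set (Set α)} {h : Set α → Fin 2} {x : α} :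
    x ∈ BoolComb 𝓐 h ↔ ∀ A ∈ 𝓐, (x ∈ A ↔ h A = 0) := by
  simp only [BoolComb, mem_iInter]
  refine forall₂_congr fun A _ => ?_
  split_ifs with hA <;> simp [hA]

/-- A reaping family on an infinite set: all countably infinite subsets. -/
theorem exists_mem_not_splits_of_infinite {K : Type} [Infinite K] (S : Set K) :
    ∃ r ∈ {r : Set K | #r = ℵ₀}, ¬ Splits S r := by
  rcases S.finite_or_infinite with hS | hS
  · have : Infinite (Sᶜ : Set K) := hS.infinite_compl.to_subtype
    obtain ⟨r, hr, hcard⟩ :=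
      Cardinal.le_mk_iff_exists_subset.1 (Cardinal.aleph0_le_mk (Sᶜ : Set K))
    exact ⟨r, hcard, fun h => h.1 (hS.subset inter_subset_right)⟩
  · have : Infinite S := hS.to_subtype
    obtain ⟨r, hr, hcard⟩ := Cardinal.le_mk_iff_exists_subset.1 (Cardinal.aleph0_le_mk S)
    exact ⟨r, hcard, fun h => h.2 (by simp [sdiff_eq_empty.2 hr])⟩

theorem mk_setOf_mk_eq_aleph0_le {K : Type} (hK : #K ≤ 𝔠) :
    #{r : Set K | #r = ℵ₀} ≤ 𝔠 :=
  calc #{r : Set K | #r = ℵ₀} ≤ #{r : Set K // #r ≤ ℵ₀} :=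
        Cardinal.mk_le_mk_of_subset fun _ hr => le_of_eq hr
    _ ≤ max #K ℵ₀ ^ ℵ₀ := Cardinal.mk_bounded_set_le K ℵ₀
    _ ≤ 𝔠 ^ ℵ₀ := Cardinal.power_le_power_right (max_le hK Cardinal.aleph0_le_continuum)
    _ = 𝔠 := Cardinal.continuum_power_aleph0

theorem reapingNumber_aleph0_le_continuum {κ : Cardinal} (hκ : ℵ₀ ≤ κ) (hκc : κ ≤ 𝔠) :
    reapingNumber ℵ₀ κ ≤ 𝔠 := by
  have : Infinite κ.out := Cardinal.infinite_iff.2 (by simpa using hκ)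
  refine (csInf_le' ?_).trans (mk_setOf_mk_eq_aleph0_le (K := κ.out) (by simpa using hκc))
  exact ⟨_, rfl, fun _ hr => hr, exists_mem_not_splits_of_infinite⟩

/-- A set not splitting an infinite sequence eventually contains it or eventually avoids it. -/
theorem exists_eventually_mem_iff_of_not_splits {K : Type} {S : Set K} {f : ℕ → K}
    (hf : Function.Injective f) (h : ¬ Splits S (range f)) :
    ∃ (N : ℕ) (b : Fin 2), ∀ n, N ≤ n → (f n ∈ S ↔ b = 0) := by
  rw [Splits, not_and_or, not_infinite, not_infinite] at h
  rcases h with h | h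
  · obtain ⟨N, hN⟩ := (h.preimage hf.injOn).bddAbove
    refine ⟨N + 1, 1, fun n hn => ?_⟩
    simp only [one_ne_zero, iff_false]
    intro hS
    have := hN (show n ∈ f ⁻¹' (range f ∩ S) from ⟨mem_range_self n, hS⟩)
    omega
  · obtain ⟨N, hN⟩ := (h.preimage hf.injOn).bddAbove
    refine ⟨N + 1, 0, fun n hn => ?_⟩
    simp only [iff_true]
    by_contra hS
    have := hN (show n ∈ f ⁻¹' (range f \ S) from ⟨mem_range_self n, hS⟩)
    omega

/-- If `#C` is regular and uncountable, a barely independent family indexed by `K` forces all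
reaping families on `K` to have size at least `#C`. -/
theorem KBarelyIndependent.le_mk_of_reaping {C K : Type} (hC : (#C).IsRegular) (hC' : ℵ₀ < #C)
    {A : K → Set C} (hA : Function.Injective A) (hI : KBarelyIndependent ℵ₀ (range A))
    {R : Set (Set K)} (hR : ∀ r ∈ R, #r = ℵ₀) (hreap : ∀ S : Set K, ∃ r ∈ R, ¬ Splits S r) :
    #C ≤ #R := by
  by_contra! hlt
  have henum : ∀ r : R, ∃ f : ℕ → K, Function.Injective f ∧ range f = r := fun r => by
    obtain ⟨e⟩ := Cardinal.eq.1 ((hR r r.2).trans Cardinal.mk_nat.symm)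
    refine ⟨fun n => (e.symm n : K), Subtype.val_injective.comp e.symm.injective, ?_⟩
    ext x
    exact ⟨by rintro ⟨n, rfl⟩; exact (e.symm n).2, fun hx => ⟨e ⟨x, hx⟩, by simp⟩⟩
  choose f hf hfr using henum
  have hcode : ∀ x : C, ∃ p : R × ℕ × Fin 2,
      ∀ n, p.2.1 ≤ n → (x ∈ A (f p.1 n) ↔ p.2.2 = 0) := fun x => by
    obtain ⟨r, hr, hns⟩ := hreap {k | x ∈ A k}
    rw [show r = range (f ⟨r, hr⟩) from (hfr ⟨r, hr⟩).symm] at hns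
    obtain ⟨N, b, h⟩ := exists_eventually_mem_iff_of_not_splits (hf _) hns
    exact ⟨(⟨r, hr⟩, N, b), h⟩
  choose φ hφ using hcode
  have hsmall : #(R × ℕ × Fin 2) < #C := by
    rw [Cardinal.mk_prod, Cardinal.lift_id, Cardinal.lift_id]
    exact Cardinal.mul_lt_of_lt hC'.le hlt ((Cardinal.mk_le_aleph0).trans_lt hC')
  obtain ⟨⟨r, N, b⟩, hp⟩ := Cardinal.infinite_pigeonhole_card φ #C le_rfl hC'.le
    (by rwa [hC.cof_ord])
  refine (hI.2.2.2 (range fun n => A (f r (N + n))) ?_ ?_ fun _ => b).not_ge (hp.trans ?_)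
  · rintro _ ⟨n, rfl⟩
    exact mem_range_self _
  · exact (Cardinal.mk_range_eq _ (hA.comp ((hf r).comp (add_right_injective N)))).trans
      Cardinal.mk_nat
  · refine Cardinal.mk_le_mk_of_subset fun x hx => mem_boolComb.2 ?_
    rintro _ ⟨n, rfl⟩
    have hx' : φ x = (r, N, b) := hx
    have := hφ x (N + n)
    rw [hx'] at this
    exact this (Nat.le_add_right _ _)

/-- If no fewer than `#C` infinite sets suffice to reap all subsets of `K`, then there is a
sequence of subsets of `K`, indexed by the initial ordinal of `C`, that eventually splits every
countably infinite set and realizes every finite pattern `#C` times. -/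
theorem exists_splitting_sequence {K : Type} {c : Cardinal} (hc : ℵ₀ ≤ c)
    [Infinite K] (hK : #K ≤ c) (hcount : #{r : Set K | #r = ℵ₀} ≤ c)
    (hreap : ∀ R : Set (Set K), #R < c → (∀ r ∈ R, #r = ℵ₀) →
      ∃ S : Set K, ∀ r ∈ R, Splits S r) :
    ∃ S : c.ord.ToType → Set K,
      (∀ r : Set K, #r = ℵ₀ → ∃ b, ∀ a, b < a → Splits (S a) r) ∧
      ∀ F G : Finset K, #{a | ∀ k ∈ F, (k ∈ S a ↔ k ∈ G)} = c := by
  have hT : #c.ord.ToType = c := Cardinal.mk_ord_toType c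
  obtain ⟨e⟩ : Nonempty ({r : Set K | #r = ℵ₀} ↪ c.ord.ToType) := by
    rw [← Cardinal.le_def, hT]
    exact hcount
  have hprod : #(c.ord.ToType × Finset K × Finset K) = #c.ord.ToType := by
    have hF : #(Finset K × Finset K) = #K := by
      simp [Cardinal.mul_eq_self (Cardinal.aleph0_le_mk K)]
    rw [Cardinal.mk_prod, hF, Cardinal.lift_id, Cardinal.lift_id, hT]
    exact Cardinal.mul_eq_left hc hK (Cardinal.mk_ne_zero K)
  obtain ⟨g⟩ := Cardinal.eq.1 hprod.symm
  have hstep : ∀ a : c.ord.ToType, ∃ S : Set K,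
      ∀ r : {r : Set K | #r = ℵ₀}, e r < a → Splits S r := fun a => by
    obtain ⟨S, hS⟩ := hreap (Subtype.val '' (e ⁻¹' Iio a))
      ((Cardinal.mk_image_le.trans
        (Cardinal.mk_preimage_of_injective _ _ e.injective)).trans_lt
        ((Cardinal.mk_Iio_lt a (by simp)).trans_eq hT))
      (by rintro _ ⟨r, _, rfl⟩; exact r.2)
    exact ⟨S, fun r hr => hS r ⟨r, hr, rfl⟩⟩
  choose S₀ hS₀ using hstep
  let F' := fun a => (g a).2.1
  let G' := fun a => (g a).2.2
  refine ⟨fun a => {k | (k ∈ F' a ∧ k ∈ G' a) ∨ (k ∉ F' a ∧ k ∈ S₀ a)}, ?_, ?_⟩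
  · intro r hr
    refine ⟨e ⟨r, hr⟩, fun a ha => ?_⟩
    have h := hS₀ a ⟨r, hr⟩ ha
    refine ⟨(h.1.sdiff (F' a).finite_toSet).mono ?_, (h.2.sdiff (F' a).finite_toSet).mono ?_⟩
    · rintro k ⟨⟨hk, hkS⟩, hkF⟩
      exact ⟨hk, Or.inr ⟨hkF, hkS⟩⟩
    · rintro k ⟨⟨hk, hkS⟩, hkF⟩
      refine ⟨hk, ?_⟩
      rintro (h | h)
      exacts [hkF h.1, hkS h.2]
  · intro F G
    refine le_antisymm ((Cardinal.mk_set_le _).trans_eq hT) ?_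
    conv_lhs => rw [← hT]
    refine Cardinal.mk_le_of_injective (f := fun a => ⟨g.symm (a, F, G), ?_⟩) ?_
    · intro k hk
      simp [F', G', hk]
    · intro a b hab
      simpa using hab

/-- A sequence of sets as in `exists_splitting_sequence` gives a barely independent family. -/
theorem kBarelyIndependent_range {C K : Type} [Infinite K] {S : C → Set K}
    (hinf : ∀ r : Set K, #r = ℵ₀ → #{x | ¬ Splits (S x) r} < #C)
    (hfin : ∀ F G : Finset K, #{x | ∀ k ∈ F, (k ∈ S x ↔ k ∈ G)} = #C) [Nonempty C] :
    Function.Injective (fun k => {x | k ∈ S x}) ∧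
      KBarelyIndependent ℵ₀ (range fun k => {x | k ∈ S x}) := by
  classical
  have hinj : Function.Injective (fun k => {x | k ∈ S x}) := by
    intro k l hkl
    by_contra hne
    have h := hfin {k, l} {k}
    have hpos : #{x | ∀ j ∈ ({k, l} : Finset K), (j ∈ S x ↔ j ∈ ({k} : Finset K))} ≠ 0 := by
      rw [h]; exact Cardinal.mk_ne_zero C
    obtain ⟨⟨x, hx⟩⟩ := Cardinal.mk_ne_zero_iff.1 hpos
    have hk := (hx k (by simp)).2 (by simp)
    have hl := mt (hx l (by simp)).1 (by simpa using Ne.symm hne)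
    exact hl ((Set.ext_iff.1 hkl x).1 hk)
  refine ⟨hinj, ?_, ?_, ?_, ?_⟩
  · rw [Cardinal.mk_range_eq _ hinj]
    exact Cardinal.aleph0_le_mk K
  · rintro _ ⟨k, rfl⟩
    simpa using hfin {k} {k}
  · intro 𝓐 h𝓐 _ hlt h
    have hFfin : ((fun k => {x | k ∈ S x}) ⁻¹' 𝓐).Finite :=
      (Cardinal.lt_aleph0_iff_set_finite.1 hlt).preimage hinj.injOn
    refine le_antisymm (Cardinal.mk_set_le _) ?_
    rw [← hfin hFfin.toFinset (hFfin.toFinset.filter fun k => h {x | k ∈ S x} = 0)]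
    refine Cardinal.mk_le_mk_of_subset fun x hx => mem_boolComb.2 fun A hA => ?_
    obtain ⟨k, rfl⟩ := h𝓐 hA
    have hk : k ∈ hFfin.toFinset := by simpa using hA
    have := hx k hk
    rw [Finset.mem_filter] at this
    exact this.trans (and_iff_right hk)
  · intro 𝓐 h𝓐 hcard h
    have hD : ((fun k => {x | k ∈ S x}) ⁻¹' 𝓐).Infinite := by
      refine Infinite.preimage ?_ h𝓐
      exact Cardinal.infinite_iff.2 hcard.ge |> infinite_coe_iff.1
    have hhom : ∃ (b : Prop) (r : Set K), #r = ℵ₀ ∧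
        ∀ k ∈ r, {x | k ∈ S x} ∈ 𝓐 ∧ (h {x | k ∈ S x} = 0 ↔ b) := by
      set D := (fun k => {x | k ∈ S x}) ⁻¹' 𝓐
      set Z : Set K := {k | h {x | k ∈ S x} = 0}
      rw [← inter_union_sdiff D Z, infinite_union] at hD
      rcases hD with hD | hD
      all_goals
        obtain ⟨r, hr, hrc⟩ := Cardinal.le_mk_iff_exists_subset.1
          (Cardinal.infinite_iff.1 hD.to_subtype)
      · exact ⟨True, r, hrc, fun k hk => ⟨(hr hk).1, iff_true_intro (hr hk).2⟩⟩
      · exact ⟨False, r, hrc, fun k hk => ⟨(hr hk).1, iff_false_intro (hr hk).2⟩⟩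
    obtain ⟨b, r, hrc, hr⟩ := hhom
    refine (Cardinal.mk_le_mk_of_subset fun x hx => ?_).trans_lt (hinf r hrc)
    have hb : ∀ k ∈ r, (k ∈ S x ↔ b) := fun k hk =>
      (mem_boolComb.1 hx _ (hr k hk).1).trans (hr k hk).2
    rintro ⟨h₁, h₂⟩
    obtain ⟨k, hk, hkS⟩ := h₁.nonempty
    obtain ⟨l, hl, hlS⟩ := h₂.nonempty
    exact hlS ((hb l hl).2 ((hb k hk).1 hkS))

/-- Assume `𝔠` is regular and let `κ ≤ 𝔠` be an infinite regular cardinal. Then there is a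
barely independent (i.e. `ℵ₀`-barely independent) family over `𝔠` of cardinality `κ` if and
only if `𝔯(ω, κ) = 𝔠`. -/
theorem stmt11 (hcreg : Cardinal.continuum.IsRegular)
    (κ : Cardinal) (hκ : ℵ₀ ≤ κ) (hκreg : κ.IsRegular) (hκc : κ ≤ Cardinal.continuum) :
    (∃ I : Set (Set Cardinal.continuum.out), KBarelyIndependent ℵ₀ I ∧ #I = κ) ↔
      reapingNumber ℵ₀ κ = Cardinal.continuum := by
  have hreg : (𝔠 : Cardinal.{0}).IsRegular := by
    rwa [← Cardinal.isRegular_lift_iff, Cardinal.lift_continuum]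
  have hC : #(𝔠 : Cardinal.{0}).out = 𝔠 := Cardinal.mk_out _
  have : Infinite κ.out := Cardinal.infinite_iff.2 (by simpa using hκ)
  constructor
  · rintro ⟨I, hI, hIκ⟩
    refine (reapingNumber_aleph0_le_continuum hκ hκc).antisymm (le_csInf ?_ ?_)
    · exact ⟨_, _, rfl, fun _ hr => hr, exists_mem_not_splits_of_infinite⟩
    · rintro _ ⟨R, rfl, hR, hreap⟩
      obtain ⟨e⟩ := Cardinal.eq.1 ((Cardinal.mk_out κ).trans hIκ.symm)
      have hrange : range (fun k => (e k : Set (𝔠 : Cardinal.{0}).out)) = I := by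
        rw [show (fun k => (e k : Set _)) = Subtype.val ∘ e from rfl, e.surjective.range_comp,
          Subtype.range_coe]
      have := KBarelyIndependent.le_mk_of_reaping (by rwa [hC])
        (by rw [hC]; exact Cardinal.aleph0_lt_continuum)
        (A := fun k => e k) (Subtype.val_injective.comp e.injective) (by rwa [hrange]) hR hreap
      rwa [hC] at this
  · intro hr
    obtain ⟨S, hS₁, hS₂⟩ := exists_splitting_sequence (K := κ.out) Cardinal.aleph0_le_continuum
      (by simpa using hκc) (mk_setOf_mk_eq_aleph0_le (by simpa using hκc)) (fun R hlt hR => by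
        by_contra! hns
        exact notMem_of_lt_csInf' (hlt.trans_eq hr.symm) ⟨R, rfl, hR, hns⟩)
    obtain ⟨e⟩ := Cardinal.eq.1 (hC.trans (Cardinal.mk_ord_toType 𝔠).symm)
    have hpre : ∀ s : Set (𝔠 : Cardinal.{0}).ord.ToType, #(e ⁻¹' s) = #s := fun s =>
      Cardinal.mk_preimage_equiv e s
    have : Nonempty (𝔠 : Cardinal.{0}).out :=
      Cardinal.mk_ne_zero_iff.1 (by rw [hC]; exact Cardinal.continuum_ne_zero)
    obtain ⟨hinj, hI⟩ := kBarelyIndependent_range (S := S ∘ e)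
      (fun r hrc => by
        obtain ⟨b, hb⟩ := hS₁ r hrc
        have hsub : {x | ¬ Splits ((S ∘ e) x) r} ⊆ e ⁻¹' insert b (Iio b) := fun x hx => by
          rw [mem_preimage, Iio_insert]
          exact not_lt.1 fun h => hx (hb _ h)
        refine (Cardinal.mk_le_mk_of_subset hsub).trans_lt ?_
        rw [hpre, hC]
        exact Cardinal.mk_insert_le.trans_lt (Cardinal.add_lt_of_lt
          Cardinal.aleph0_le_continuum
          ((Cardinal.mk_Iio_lt b (by simp)).trans_eq (Cardinal.mk_ord_toType 𝔠))
          (Cardinal.one_lt_aleph0.trans Cardinal.aleph0_lt_continuum)))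
      (fun F G => ((hpre {a | ∀ k ∈ F, (k ∈ S a ↔ k ∈ G)}).trans (hS₂ F G)).trans hC.symm)
    exact ⟨_, hI, (Cardinal.mk_range_eq _ hinj).trans (Cardinal.mk_out κ)⟩
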